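/- For all x, y ∈ ℂ with x ∉ Λ and y ∉ Λ one has ℘(x|τ) − ℘(y|τ) = − θ₁'(τ)² · θ₁(x+y|τ)θ₁(x−y|τ) / (θ₁(x|τ)²θ₁(y|τ)²) (the addition formula for the Weierstrass sigma-function). -/

import Mathlib

noncomputable section

open Complex

namespace Liu

/-- `π` as a complex number. -/
def piC : ℂ := Real.pi

/-- The nome `q = exp(2πiτ)`. -/
def qq (τ : ℂ) : ℂ := exp (2 * piC * I * τ)

/-- Jacobi theta function θ₁(z|τ). -/
def theta1 (z τ : ℂ) : ℂ :=
  -I * exp (piC * I * τ / 4) *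
    ∑' n : ℤ, (-1 : ℂ) ^ n * exp (piC * I * τ * (n : ℂ) * ((n : ℂ) + 1)) *
      exp ((2 * (n : ℂ) + 1) * I * z)

/-- Jacobi theta function θ₂(z|τ). -/
def theta2 (z τ : ℂ) : ℂ :=
  2 * ∑' n : ℕ, exp (piC * I * τ * (2 * (n : ℂ) + 1) ^ 2 / 4) * cos ((2 * (n : ℂ) + 1) * z)

/-- Jacobi theta function θ₃(z|τ). -/
def theta3 (z τ : ℂ) : ℂ :=
  1 + 2 * ∑' n : ℕ, exp (piC * I * τ * ((n : ℂ) + 1) ^ 2) * cos (2 * ((n : ℂ) + 1) * z)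

/-- Jacobi theta function θ₄(z|τ). -/
def theta4 (z τ : ℂ) : ℂ :=
  1 + 2 * ∑' n : ℕ, (-1 : ℂ) ^ (n + 1) * exp (piC * I * τ * ((n : ℂ) + 1) ^ 2) *
    cos (2 * ((n : ℂ) + 1) * z)

/-- θ₁'(τ) = (∂θ₁/∂z)(0|τ). -/
def theta1' (τ : ℂ) : ℂ := deriv (fun z => theta1 z τ) 0

/-- The Dedekind eta function. -/
def eta (τ : ℂ) : ℂ := exp (piC * I * τ / 12) * ∏' n : ℕ, (1 - qq τ ^ (n + 1))

/-- Eisenstein series L = E₂. -/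
def EisL (τ : ℂ) : ℂ :=
  1 - 24 * ∑' n : ℕ, ((n : ℂ) + 1) * qq τ ^ (n + 1) / (1 - qq τ ^ (n + 1))

/-- Eisenstein series M = E₄. -/
def EisM (τ : ℂ) : ℂ :=
  1 + 240 * ∑' n : ℕ, ((n : ℂ) + 1) ^ 3 * qq τ ^ (n + 1) / (1 - qq τ ^ (n + 1))

/-- The period lattice Λ = {mπ + nπτ : m, n ∈ ℤ}. -/
def Lambda (τ : ℂ) : Set ℂ := {z | ∃ m n : ℤ, z = (m : ℂ) * piC + (n : ℂ) * piC * τ}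

/-- The Weierstrass ℘ function attached to the lattice with periods π and πτ. -/
def wp (τ z : ℂ) : ℂ :=
  1 / z ^ 2 + ∑' p : ℤ × ℤ,
    if p = (0, 0) then 0
    else 1 / (z - ((p.1 : ℂ) * piC + (p.2 : ℂ) * piC * τ)) ^ 2
      - 1 / ((p.1 : ℂ) * piC + (p.2 : ℂ) * piC * τ) ^ 2

lemma piC_ne_zero : piC ≠ 0 := by simp [piC, Real.pi_ne_zero]

lemma exp_piC_mul_I : exp (piC * I) = -1 := exp_pi_mul_I

/-! ### The theta function -/

lemma theta1_eq_jacobiTheta₂ (z τ : ℂ) :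
    theta1 z τ = -I * exp (piC * I * τ / 4) * exp (I * z) *
      jacobiTheta₂ (z / piC + 1 / 2 + τ / 2) τ := by
  rw [theta1, jacobiTheta₂, mul_assoc _ (exp (I * z)), ← tsum_mul_left (a := exp (I * z))]
  refine congrArg _ (tsum_congr fun n ↦ ?_)
  rw [jacobiTheta₂_term, ← exp_piC_mul_I, ← exp_int_mul, ← exp_add, ← exp_add, ← exp_add]
  congr 1
  have := piC_ne_zero
  change _ = I * z + (2 * piC * I * n * (z / piC + 1 / 2 + τ / 2) + piC * I * n ^ 2 * τ)
  field_simp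
  ring

lemma differentiable_theta1 {τ : ℂ} (hτ : 0 < τ.im) : Differentiable ℂ (theta1 · τ) := by
  simp_rw [theta1_eq_jacobiTheta₂]
  intro z
  have : DifferentiableAt ℂ (fun z ↦ jacobiTheta₂ (z / piC + 1 / 2 + τ / 2) τ) z :=
    DifferentiableAt.comp (g := (jacobiTheta₂ · τ)) (f := fun z ↦ z / piC + 1 / 2 + τ / 2) z
      (differentiableAt_jacobiTheta₂_fst _ hτ) (by fun_prop)
  fun_prop

lemma theta1_add_piC (z τ : ℂ) : theta1 (z + piC) τ = -theta1 z τ := by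
  have h : (z + piC) / piC + 1 / 2 + τ / 2 = z / piC + 1 / 2 + τ / 2 + 1 := by
    field_simp [piC_ne_zero]
    ring
  rw [theta1_eq_jacobiTheta₂, theta1_eq_jacobiTheta₂, h, jacobiTheta₂_add_left, mul_add I, exp_add,
    mul_comm I piC, exp_piC_mul_I]
  ring

lemma theta1_add_piC_mul (z τ : ℂ) :
    theta1 (z + piC * τ) τ = -exp (-(piC * I * τ + 2 * I * z)) * theta1 z τ := by
  have h : (z + piC * τ) / piC + 1 / 2 + τ / 2 = z / piC + 1 / 2 + τ / 2 + τ := by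
    field_simp [piC_ne_zero]
    ring
  have e : exp (I * (z + piC * τ)) * exp (-piC * I * (τ + 2 * (z / piC + 1 / 2 + τ / 2))) =
      -exp (-(piC * I * τ + 2 * I * z)) * exp (I * z) := by
    rw [← exp_add, neg_mul (exp _), ← exp_add, ← neg_one_mul (exp _), ← exp_piC_mul_I, ← exp_add,
      exp_eq_exp_iff_exists_int]
    refine ⟨-1, ?_⟩
    change _ = _ + _ * (2 * piC * I)
    have := piC_ne_zero
    field_simp
    push_cast
    ring
  rw [theta1_eq_jacobiTheta₂, theta1_eq_jacobiTheta₂, h, jacobiTheta₂_add_left']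
  change _ * _ * _ * (exp (-piC * I * _) * _) = _
  linear_combination (-I * exp (piC * I * τ / 4) * jacobiTheta₂ (z / piC + 1 / 2 + τ / 2) τ) * e

lemma theta1_neg (z τ : ℂ) : theta1 (-z) τ = -theta1 z τ := by
  have h : jacobiTheta₂ (-z / piC + 1 / 2 + τ / 2) τ =
      (exp (-piC * I * (τ + 2 * (z / piC - 1 / 2 - τ / 2))))⁻¹ *
        jacobiTheta₂ (z / piC + 1 / 2 + τ / 2) τ := by
    rw [← jacobiTheta₂_neg_left,
      show -(-z / piC + 1 / 2 + τ / 2) = z / piC - 1 / 2 - τ / 2 by ring,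
      show z / piC + 1 / 2 + τ / 2 = z / piC - 1 / 2 - τ / 2 + τ + 1 by ring,
      jacobiTheta₂_add_left, jacobiTheta₂_add_left']
    change _ = _ * (exp (-piC * I * _) * _)
    rw [inv_mul_cancel_left₀ (exp_ne_zero _)]
  have e : exp (I * -z) * (exp (-piC * I * (τ + 2 * (z / piC - 1 / 2 - τ / 2))))⁻¹ =
      -exp (I * z) := by
    rw [← exp_neg, ← exp_add, ← neg_one_mul (exp _), ← exp_piC_mul_I, ← exp_add,
      exp_eq_exp_iff_exists_int]
    refine ⟨-1, ?_⟩
    change _ = _ + _ * (2 * piC * I)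
    have := piC_ne_zero
    field_simp
    push_cast
    ring
  rw [theta1_eq_jacobiTheta₂, theta1_eq_jacobiTheta₂, h]
  linear_combination (-I * exp (piC * I * τ / 4) * jacobiTheta₂ (z / piC + 1 / 2 + τ / 2) τ) * e

lemma theta1_zero (τ : ℂ) : theta1 0 τ = 0 := by
  have h := theta1_neg 0 τ
  rw [neg_zero] at h
  exact self_eq_neg.mp h

lemma exists_jacobiTheta₂_ne_zero {τ : ℂ} (hτ : 0 < τ.im) : ∃ z, jacobiTheta₂ z τ ≠ 0 := by
  by_contra! h
  have hint (n : ℤ) : ∫ t in (0 : ℝ)..1, jacobiTheta₂_term n t τ = if n = 0 then 1 else 0 := by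
    simp only [jacobiTheta₂_term, exp_add]
    rw [intervalIntegral.integral_mul_const]
    split_ifs with hn
    · simp [hn]
    · rw [integral_exp_mul_complex (by simp [hn, Real.pi_ne_zero])]
      have : exp (2 * Real.pi * I * n) = 1 := by
        rw [mul_comm, exp_int_mul_two_pi_mul_I]
      simp [this]
  have hsum : HasSum (fun n : ℤ ↦ ∫ t in (0 : ℝ)..1, jacobiTheta₂_term n t τ)
      (∫ t in (0 : ℝ)..1, jacobiTheta₂ t τ) := by
    refine intervalIntegral.hasSum_integral_of_dominated_convergence
      (fun n _ ↦ ‖jacobiTheta₂_term n 0 τ‖) (fun n ↦ ?_) (fun n ↦ ?_) ?_ ?_ ?_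
    · exact Continuous.aestronglyMeasurable (by unfold jacobiTheta₂_term; fun_prop)
    · refine .of_forall fun t _ ↦ le_of_eq ?_
      simp [norm_jacobiTheta₂_term]
    · exact .of_forall fun t _ ↦ ((summable_jacobiTheta₂_term_iff 0 τ).mpr hτ).norm
    · simp
    · exact .of_forall fun t _ ↦ hasSum_jacobiTheta₂_term t hτ
  simp only [hint, h, intervalIntegral.integral_zero] at hsum
  exact one_ne_zero ((hasSum_ite_eq 0 (1 : ℂ)).unique hsum)

lemma exists_theta1_ne_zero {τ : ℂ} (hτ : 0 < τ.im) : ∃ z, theta1 z τ ≠ 0 := by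
  obtain ⟨w, hw⟩ := exists_jacobiTheta₂_ne_zero hτ
  refine ⟨piC * (w - 1 / 2 - τ / 2), ?_⟩
  rw [theta1_eq_jacobiTheta₂, mul_div_cancel_left₀ _ piC_ne_zero,
    show w - 1 / 2 - τ / 2 + 1 / 2 + τ / 2 = w by ring]
  simp [hw, exp_ne_zero]

/-! ### Entire functions that are quasi-periodic of order two -/

lemma integral_add_eq_of_periodic {g : ℂ → ℂ} (hg : Differentiable ℂ g)
    (hper : ∀ z, g (z + piC) = g z) (w : ℂ) :
    ∫ t in (0 : ℝ)..Real.pi, g (t + w) = ∫ t in (0 : ℝ)..Real.pi, g t := by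
  obtain ⟨P, hP⟩ := hg.isExactOn_univ
  have hI (w : ℂ) : ∫ t in (0 : ℝ)..Real.pi, g (t + w) = P (w + piC) - P w := by
    have := intervalIntegral.integral_eq_sub_of_hasDerivAt (a := 0) (b := Real.pi)
      (f := fun t : ℝ ↦ P (t + w)) (f' := fun t : ℝ ↦ g (t + w))
      (fun t _ ↦ ((hP (t + w) trivial).comp_add_const (t : ℂ) w).comp_ofReal)
      (Continuous.intervalIntegrable (hg.continuous.comp (by fun_prop)) _ _)
    simpa [piC, add_comm] using this
  have hd (w : ℂ) : HasDerivAt (fun w ↦ P (w + piC) - P w) 0 w := by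
    simpa [hper] using
      ((hP (w + piC) trivial).comp_add_const w piC).fun_sub (hP w trivial)
  have hc := is_const_of_deriv_eq_zero (fun w ↦ (hd w).differentiableAt) (fun w ↦ (hd w).deriv) w 0
  rw [hI, hc, ← hI]
  simp

lemma eq_zero_of_fourierCoeff_eq_zero {f : ℝ → ℂ} (hf : Continuous f)
    (hper : f.Periodic Real.pi)
    (h : ∀ n : ℤ, ∫ t in (0 : ℝ)..Real.pi, exp (-2 * n * I * t) * f t = 0) (t : ℝ) : f t = 0 := by
  have : Fact (0 < Real.pi) := ⟨Real.pi_pos⟩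
  let F : C(AddCircle Real.pi, ℂ) := ⟨hper.lift, continuous_coinduced_dom.mpr hf⟩
  have hF (n : ℤ) : fourierCoeff F n = 0 := by
    rw [fourierCoeff_eq_intervalIntegral F n 0, zero_add]
    convert smul_zero _
    rw [← h n]
    congr 1 with x
    rw [fourier_coe_apply, smul_eq_mul]
    congr 2
    push_cast
    field_simp
  have hs : fourierCoeff F = 0 := funext hF
  have := has_pointwise_sum_fourier_series_of_summable (f := F) (hs ▸ summable_zero) t
  simp only [hF, zero_smul] at this
  exact this.unique hasSum_zero

/-- Entire functions transforming under the periods `π` and `πτ` like the square of `θ₁`. -/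
structure IsOrderTwo (τ : ℂ) (f : ℂ → ℂ) : Prop where
  differentiable : Differentiable ℂ f
  add_piC : ∀ z, f (z + piC) = f z
  add_piC_mul : ∀ z, f (z + piC * τ) = exp (-(2 * piC * I * τ + 4 * I * z)) * f z

/-- The Fourier coefficients of a function of period `π`. -/
def coeffPi (f : ℂ → ℂ) (n : ℤ) : ℂ :=
  ∫ t in (0 : ℝ)..Real.pi, exp (-2 * n * I * t) * f t

namespace IsOrderTwo

variable {τ : ℂ} {f g h : ℂ → ℂ}

lemma coeffPi_add_two (hf : IsOrderTwo τ f) (n : ℤ) :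
    exp (-2 * piC * I * τ * (n + 1)) * coeffPi f (n + 2) = coeffPi f n := by
  have hd := hf.differentiable
  have key := integral_add_eq_of_periodic (g := fun z ↦ exp (-2 * n * I * z) * f z) (by fun_prop)
    (fun z ↦ by
      rw [hf.add_piC]
      congr 1
      rw [exp_eq_exp_iff_exists_int]
      refine ⟨-n, ?_⟩
      change _ = _ + _ * (2 * piC * I)
      push_cast
      ring) (piC * τ)
  rw [coeffPi, coeffPi, ← key, ← intervalIntegral.integral_const_mul]
  congr 1 with t
  rw [hf.add_piC_mul, ← mul_assoc, ← mul_assoc, ← exp_add, ← exp_add]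
  congr 2
  push_cast
  ring

lemma coeffPi_eq_zero (hf : IsOrderTwo τ f) (h0 : coeffPi f 0 = 0) (h1 : coeffPi f 1 = 0)
    (n : ℤ) : coeffPi f n = 0 := by
  have step (n : ℤ) : coeffPi f n = 0 ↔ coeffPi f (n + 2) = 0 := by
    rw [← hf.coeffPi_add_two n]
    simp [exp_ne_zero]
  have : coeffPi f n = 0 ∧ coeffPi f (n + 1) = 0 := by
    induction n using Int.induction_on with
    | zero => simpa using ⟨h0, h1⟩
    | succ n ih => exact ⟨ih.2, by simpa [add_assoc] using (step _).mp ih.1⟩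
    | pred n ih =>
      refine ⟨(step _).mpr ?_, ?_⟩
      · convert ih.2 using 2
        ring
      · simpa using ih.1
  exact this.1

lemma eq_zero (hf : IsOrderTwo τ f) (h0 : coeffPi f 0 = 0) (h1 : coeffPi f 1 = 0) : f = 0 := by
  have hc := hf.differentiable.continuous
  have hreal : ∀ t : ℝ, f t = 0 := eq_zero_of_fourierCoeff_eq_zero (f := fun t : ℝ ↦ f t)
    (by fun_prop) (fun t ↦ by simpa [piC] using hf.add_piC t) (hf.coeffPi_eq_zero h0 h1)
  have ha : AnalyticOnNhd ℂ f Set.univ :=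
    hf.differentiable.differentiableOn.analyticOnNhd isOpen_univ
  refine ha.eq_of_frequently_eq (g := 0) (z₀ := 0) (fun _ _ ↦ analyticAt_const) ?_
  have ht : Filter.Tendsto (fun t : ℝ ↦ (t : ℂ)) (nhdsWithin 0 {0}ᶜ) (nhdsWithin 0 {0}ᶜ) := by
    refine tendsto_nhdsWithin_iff.mpr ⟨?_, ?_⟩
    · exact (Complex.continuous_ofReal.tendsto' 0 0 (by simp)).mono_left nhdsWithin_le_nhds
    · filter_upwards [self_mem_nhdsWithin] with t ht
      simpa using ht
  exact ht.frequently (Filter.Frequently.of_forall hreal)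

lemma coeffPi_linear (hf : IsOrderTwo τ f) (hg : IsOrderTwo τ g) (hh : IsOrderTwo τ h)
    (a b c : ℂ) (n : ℤ) :
    coeffPi (fun z ↦ a * f z + b * g z + c * h z) n =
      a * coeffPi f n + b * coeffPi g n + c * coeffPi h n := by
  have hf' := hf.differentiable.continuous
  have hg' := hg.differentiable.continuous
  have hh' := hh.differentiable.continuous
  simp only [coeffPi, ← intervalIntegral.integral_const_mul]
  rw [← intervalIntegral.integral_add, ← intervalIntegral.integral_add]
  · congr 1 with t
    ring
  all_goals exact Continuous.intervalIntegrable (by fun_prop) _ _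

/-- The space of functions of order two has dimension at most two. -/
lemma exists_linear_relation (hf : IsOrderTwo τ f) (hg : IsOrderTwo τ g) (hh : IsOrderTwo τ h) :
    ∃ a b c : ℂ, (a ≠ 0 ∨ b ≠ 0 ∨ c ≠ 0) ∧ ∀ z, a * f z + b * g z + c * h z = 0 := by
  let M : Matrix (Fin 2) (Fin 3) ℂ :=
    !![coeffPi f 0, coeffPi g 0, coeffPi h 0; coeffPi f 1, coeffPi g 1, coeffPi h 1]
  obtain ⟨v, hv, hv0⟩ := (Submodule.ne_bot_iff _).mp
    (M.mulVecLin.ker_ne_bot_of_finrank_lt (by simp))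
  have hM : M.mulVec v = 0 := by simpa using hv
  have e0 := congrFun hM 0
  have e1 := congrFun hM 1
  simp [M, Matrix.mulVec, dotProduct, Fin.sum_univ_three] at e0 e1
  have hd := hf.differentiable
  have hd' := hg.differentiable
  have hd'' := hh.differentiable
  have hF : IsOrderTwo τ (fun z ↦ v 0 * f z + v 1 * g z + v 2 * h z) :=
    ⟨by fun_prop, fun z ↦ by rw [hf.add_piC, hg.add_piC, hh.add_piC],
      fun z ↦ by rw [hf.add_piC_mul, hg.add_piC_mul, hh.add_piC_mul]; ring⟩
  refine ⟨v 0, v 1, v 2, ?_, congrFun (hF.eq_zero ?_ ?_)⟩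
  · contrapose! hv0
    ext i
    fin_cases i <;> simp [hv0]
  · rw [coeffPi_linear hf hg hh]
    linear_combination e0
  · rw [coeffPi_linear hf hg hh]
    linear_combination e1

end IsOrderTwo

lemma isOrderTwo_theta1_mul {τ : ℂ} (hτ : 0 < τ.im) (y : ℂ) :
    IsOrderTwo τ (fun z ↦ theta1 (z + y) τ * theta1 (z - y) τ) where
  differentiable := by
    have hθ := differentiable_theta1 hτ
    exact (hθ.comp (differentiable_id.add_const y)).mul (hθ.comp (differentiable_id.sub_const y))
  add_piC z := by
    rw [add_right_comm, add_sub_right_comm, theta1_add_piC, theta1_add_piC, neg_mul_neg]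
  add_piC_mul z := by
    rw [add_right_comm, add_sub_right_comm, theta1_add_piC_mul, theta1_add_piC_mul,
      mul_mul_mul_comm, neg_mul_neg, ← exp_add]
    congr 2
    ring

lemma eventually_theta1_ne_zero {τ : ℂ} (hτ : 0 < τ.im) (z₀ : ℂ) :
    ∀ᶠ z in nhdsWithin z₀ {z₀}ᶜ, theta1 z τ ≠ 0 := by
  have ha : AnalyticOnNhd ℂ (theta1 · τ) Set.univ :=
    (differentiable_theta1 hτ).differentiableOn.analyticOnNhd isOpen_univ
  by_contra h
  obtain ⟨w, hw⟩ := exists_theta1_ne_zero hτ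
  refine hw (congrFun
    (ha.eq_of_frequently_eq (g := 0) (z₀ := z₀) (fun _ _ ↦ analyticAt_const) ?_) w)
  simpa [Filter.not_eventually] using h

/-! ### The Weierstrass function -/

/-- The pair of periods `π` and `πτ`. -/
def periodPair (τ : ℂ) (hτ : 0 < τ.im) : PeriodPair where
  ω₁ := piC
  ω₂ := piC * τ
  indep := by
    rw [LinearIndependent.pair_iff]
    intro s t h
    have ht : t = 0 := by
      have him := congrArg Complex.im h
      simpa [piC, Real.pi_ne_zero, hτ.ne'] using him
    subst ht
    simpa [piC_ne_zero] using h

section Weierstrass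

variable {τ : ℂ} (hτ : 0 < τ.im)

lemma mem_lattice_periodPair (z : ℂ) : z ∈ (periodPair τ hτ).lattice ↔ z ∈ Lambda τ := by
  rw [PeriodPair.mem_lattice]
  simp only [Lambda, Set.mem_ofPred_eq, periodPair, mul_assoc, eq_comm]

lemma wp_eq_weierstrassP (z : ℂ) : wp τ z = (periodPair τ hτ).weierstrassP z := by
  have h := (periodPair τ hτ).weierstrassPExcept_add 0 z
  rw [← h, PeriodPair.weierstrassPExcept, ← (periodPair τ hτ).latticeEquivProd.symm.toEquiv.tsum_eq]
  simp only [wp, ZeroMemClass.coe_zero, sub_zero]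
  rw [add_comm]
  congr 1
  · refine tsum_congr fun p ↦ ?_
    have hp : ((periodPair τ hτ).latticeEquivProd.symm p : ℂ) =
        (p.1 : ℂ) * piC + (p.2 : ℂ) * piC * τ := by
      rw [PeriodPair.latticeEquiv_symm_apply, mul_assoc]
      rfl
    have h0 : (p.1 : ℂ) * piC + (p.2 : ℂ) * piC * τ = 0 ↔ p = (0, 0) := by
      rw [← hp, ZeroMemClass.coe_eq_zero, LinearEquiv.map_eq_zero_iff]
      rfl
    simp only [LinearEquiv.coe_toEquiv, hp, h0]
  · simp

lemma theta1_eq_zero_of_mem_lattice {l : ℂ} (hl : l ∈ (periodPair τ hτ).lattice) :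
    theta1 l τ = 0 := by
  obtain ⟨m, n, rfl⟩ := PeriodPair.mem_lattice.mp hl
  have h1 : Function.Periodic (fun z ↦ theta1 z τ = 0) piC := fun z ↦ by
    simp [theta1_add_piC]
  have h2 : Function.Periodic (fun z ↦ theta1 z τ = 0) (piC * τ) := fun z ↦ by
    simp [theta1_add_piC_mul, exp_ne_zero]
  have h := (h2.int_mul n (m * piC)).trans (h1.int_mul_eq m)
  exact h.mpr (theta1_zero τ)

open Classical in
/-- The entire function extending `(℘ - c) θ₁²`. -/
def wpThetaSq (c z : ℂ) : ℂ :=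
  if z ∈ (periodPair τ hτ).lattice then deriv (theta1 · τ) z ^ 2
  else ((periodPair τ hτ).weierstrassP z - c) * theta1 z τ ^ 2

lemma wpThetaSq_of_mem {z : ℂ} (hz : z ∈ (periodPair τ hτ).lattice) (c : ℂ) :
    wpThetaSq hτ c z = deriv (theta1 · τ) z ^ 2 := if_pos hz

lemma wpThetaSq_of_notMem {z : ℂ} (hz : z ∉ (periodPair τ hτ).lattice) (c : ℂ) :
    wpThetaSq hτ c z = ((periodPair τ hτ).weierstrassP z - c) * theta1 z τ ^ 2 := if_neg hz

lemma differentiable_wpThetaSq (c : ℂ) : Differentiable ℂ (wpThetaSq hτ c) := by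
  intro l
  have hθ := differentiable_theta1 hτ
  by_cases hl : l ∈ (periodPair τ hτ).lattice
  · have hE : DifferentiableAt ℂ ((periodPair τ hτ).weierstrassPExcept l) l :=
      ((periodPair τ hτ).analyticAt_weierstrassPExcept l).differentiableAt
    have hs : DifferentiableAt ℂ (dslope (theta1 · τ) l) l :=
      ((Complex.differentiableOn_dslope Filter.univ_mem).mpr hθ.differentiableOn).differentiableAt
        Filter.univ_mem
    have hF : DifferentiableAt ℂ (fun z ↦
        ((periodPair τ hτ).weierstrassPExcept l z - 1 / l ^ 2 - c) * theta1 z τ ^ 2 +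
          dslope (theta1 · τ) l z ^ 2) l := by fun_prop
    refine hF.congr_of_eventuallyEq ?_
    filter_upwards [(periodPair τ hτ).compl_lattice_sdiff_singleton_mem_nhds l] with z hz
    have h0 := theta1_eq_zero_of_mem_lattice hτ hl
    by_cases hzl : z = l
    · subst hzl
      simp [wpThetaSq_of_mem hτ hl, h0]
    · have hz' : z ∉ (periodPair τ hτ).lattice := fun h ↦ hz ⟨h, hzl⟩
      have hne := sub_ne_zero.mpr hzl
      rw [wpThetaSq_of_notMem hτ hz', ← (periodPair τ hτ).weierstrassPExcept_add ⟨l, hl⟩,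
        dslope_of_ne _ hzl, slope_def_field, h0]
      field_simp
      ring
  · have hP := (periodPair τ hτ).differentiableOn_weierstrassP.differentiableAt
      ((periodPair τ hτ).isClosed_lattice.isOpen_compl.mem_nhds hl)
    have hF : DifferentiableAt ℂ
        (fun z ↦ ((periodPair τ hτ).weierstrassP z - c) * theta1 z τ ^ 2) l := by fun_prop
    refine hF.congr_of_eventuallyEq ?_
    filter_upwards [(periodPair τ hτ).isClosed_lattice.isOpen_compl.mem_nhds hl] with z hz
    exact wpThetaSq_of_notMem hτ hz c

lemma wpThetaSq_add {w : ℂ} (hw : w ∈ (periodPair τ hτ).lattice) {e : ℂ → ℂ}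
    (he : Differentiable ℂ e) (h : ∀ z, theta1 (z + w) τ = e z * theta1 z τ) (c z : ℂ) :
    wpThetaSq hτ c (z + w) = e z ^ 2 * wpThetaSq hτ c z := by
  by_cases hz : z ∈ (periodPair τ hτ).lattice
  · have hd : deriv (theta1 · τ) (z + w) = e z * deriv (theta1 · τ) z := by
      rw [← deriv_comp_add_const (theta1 · τ) w z]
      simp only [h]
      rw [deriv_fun_mul (he z) (differentiable_theta1 hτ z), theta1_eq_zero_of_mem_lattice hτ hz]
      simp
    rw [wpThetaSq_of_mem hτ hz, wpThetaSq_of_mem hτ (add_mem hz hw), hd, mul_pow]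
  · have hz' : z + w ∉ (periodPair τ hτ).lattice := fun h ↦ hz (by simpa using sub_mem h hw)
    rw [wpThetaSq_of_notMem hτ hz, wpThetaSq_of_notMem hτ hz', h,
      (periodPair τ hτ).weierstrassP_add_coe z ⟨w, hw⟩]
    ring

lemma isOrderTwo_wpThetaSq (c : ℂ) : IsOrderTwo τ (wpThetaSq hτ c) where
  differentiable := differentiable_wpThetaSq hτ c
  add_piC z := by
    rw [wpThetaSq_add hτ (w := piC) (periodPair τ hτ).ω₁_mem_lattice (e := fun _ ↦ -1)
      (by fun_prop) (fun z ↦ by rw [neg_one_mul]; exact theta1_add_piC z τ)]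
    ring
  add_piC_mul z := by
    rw [wpThetaSq_add hτ (w := piC * τ) (periodPair τ hτ).ω₂_mem_lattice (by fun_prop)
      (fun z ↦ theta1_add_piC_mul z τ), neg_sq, ← exp_nat_mul]
    congr 2
    push_cast
    ring

lemma exists_wpThetaSq_ne_zero (c : ℂ) : ∃ z, wpThetaSq hτ c z ≠ 0 := by
  have hc : ContinuousAt
      (fun z ↦ z ^ 2 * ((periodPair τ hτ).weierstrassPExcept 0 z - c) + 1) 0 := by
    have := ((periodPair τ hτ).analyticAt_weierstrassPExcept 0).continuousAt
    fun_prop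
  have hne := (hc.eventually_ne (y := 0) (by simp)).filter_mono (nhdsWithin_le_nhds (s := {0}ᶜ))
  have hlat := Filter.Eventually.filter_mono (nhdsWithin_le_nhds (s := {0}ᶜ))
    ((periodPair τ hτ).compl_lattice_sdiff_singleton_mem_nhds 0)
  obtain ⟨z, ⟨⟨h1, h2⟩, h3⟩, h4⟩ :=
    (((hne.and hlat).and (eventually_theta1_ne_zero hτ 0)).and self_mem_nhdsWithin).exists
  have hz0 : z ≠ 0 := h4
  refine ⟨z, ?_⟩
  have hE := (periodPair τ hτ).weierstrassPExcept_add 0 z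
  rw [wpThetaSq_of_notMem hτ (fun h ↦ h2 ⟨h, h4⟩), ← hE]
  refine mul_ne_zero (fun h ↦ h1 ?_) (pow_ne_zero 2 h3)
  simp only [ZeroMemClass.coe_zero, sub_zero] at h
  field_simp at h
  linear_combination h

lemma deriv_sq_mul_theta1_mul {y : ℂ} (hy : theta1 y τ ≠ 0) :
    theta1' τ ≠ 0 ∧ ∀ z ∉ (periodPair τ hτ).lattice,
      theta1' τ ^ 2 * (theta1 (z + y) τ * theta1 (z - y) τ) =
        -((periodPair τ hτ).weierstrassP z - (periodPair τ hτ).weierstrassP y) *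
          (theta1 z τ ^ 2 * theta1 y τ ^ 2) := by
  have hy' : y ∉ (periodPair τ hτ).lattice := fun h ↦ hy (theta1_eq_zero_of_mem_lattice hτ h)
  obtain ⟨a, b, c, habc, h⟩ := (isOrderTwo_wpThetaSq hτ
    ((periodPair τ hτ).weierstrassP y)).exists_linear_relation
      (isOrderTwo_theta1_mul hτ y) (isOrderTwo_theta1_mul hτ 0)
  have hc : c = 0 := by
    simpa [wpThetaSq_of_notMem hτ hy', theta1_zero, hy] using h y
  subst hc
  have h0 : a * theta1' τ ^ 2 = b * theta1 y τ ^ 2 := by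
    have := h 0
    rw [wpThetaSq_of_mem hτ (zero_mem _), zero_add, zero_sub, theta1_neg] at this
    rw [theta1']
    linear_combination this
  have hb : b ≠ 0 := by
    rintro rfl
    obtain ⟨z, hz⟩ := exists_wpThetaSq_ne_zero hτ ((periodPair τ hτ).weierstrassP y)
    have := h z
    simp_all
  refine ⟨fun h' ↦ ?_, fun z hz ↦ ?_⟩
  · simp [h', hb, hy] at h0
  · have := h z
    rw [wpThetaSq_of_notMem hτ hz] at this
    refine mul_left_cancel₀ hb ?_
    linear_combination theta1' τ ^ 2 * this - ((periodPair τ hτ).weierstrassP z -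
      (periodPair τ hτ).weierstrassP y) * theta1 z τ ^ 2 * h0

lemma theta1_ne_zero {x : ℂ} (hx : x ∉ (periodPair τ hτ).lattice) : theta1 x τ ≠ 0 := by
  intro h
  have hadd : Filter.Tendsto (x + ·) (nhdsWithin 0 {0}ᶜ) (nhdsWithin x {x}ᶜ) :=
    tendsto_nhdsWithin_iff.mpr
      ⟨(Continuous.tendsto' (by fun_prop) 0 x (by simp)).mono_left nhdsWithin_le_nhds,
        by filter_upwards [self_mem_nhdsWithin] with y hy using by simpa using hy⟩
  have hsub : Filter.Tendsto (x - ·) (nhdsWithin 0 {0}ᶜ) (nhdsWithin x {x}ᶜ) :=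
    tendsto_nhdsWithin_iff.mpr
      ⟨(Continuous.tendsto' (by fun_prop) 0 x (by simp)).mono_left nhdsWithin_le_nhds,
        by filter_upwards [self_mem_nhdsWithin] with y hy using by simpa using hy⟩
  obtain ⟨y, ⟨hy, hy1⟩, hy2⟩ := (((eventually_theta1_ne_zero hτ 0).and
    (hadd.eventually (eventually_theta1_ne_zero hτ x))).and
      (hsub.eventually (eventually_theta1_ne_zero hτ x))).exists
  obtain ⟨h', hmul⟩ := deriv_sq_mul_theta1_mul hτ hy
  have := hmul x hx
  simp [h, h', hy1, hy2] at this

end Weierstrass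

theorem statement2 (τ : ℂ) (hτ : 0 < τ.im) (x y : ℂ)
    (hx : x ∉ Lambda τ) (hy : y ∉ Lambda τ) :
    wp τ x - wp τ y =
      -theta1' τ ^ 2 * theta1 (x + y) τ * theta1 (x - y) τ /
        (theta1 x τ ^ 2 * theta1 y τ ^ 2) := by
  rw [← mem_lattice_periodPair hτ] at hx hy
  have hx0 := theta1_ne_zero hτ hx
  have hy0 := theta1_ne_zero hτ hy
  have h := (deriv_sq_mul_theta1_mul hτ hy0).2 x hx
  rw [wp_eq_weierstrassP hτ, wp_eq_weierstrassP hτ, eq_div_iff (by positivity)]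
  linear_combination h
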